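/- For every partition λ there exists a constant C > 0 (depending only on λ) such that for every finite field 𝔽_q, 1/q ≤ P(s_λ ↦ 0) ≤ 1/q + C/q². In other words, P(s_λ ↦ 0) = 1/q + O(1/q²) as q → ∞. -/

import Mathlib

open Finset Classical

/-- The Jacobi–Trudi matrix of a partition with `k` parts `lam 0 ≥ lam 1 ≥ …`,
with respect to a 1-indexed assignment `a : ℕ → F` of values to `h_1, h_2, …`.
The `(i,j)` entry (indices `0`-based) is `a (lam i - i + j)` if that subscript is `≥ 1`,
is `1` if it is `0`, and is `0` if it is negative. -/
def JTmat (F : Type*) [Field F] (k : ℕ) (lam : ℕ → ℕ) (a : ℕ → F) :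
    Matrix (Fin k) (Fin k) F :=
  Matrix.of fun i j =>
    if 1 ≤ (lam i : ℤ) - (i : ℤ) + (j : ℤ) then
      a ((lam i : ℤ) - (i : ℤ) + (j : ℤ)).toNat
    else if (lam i : ℤ) - (i : ℤ) + (j : ℤ) = 0 then 1 else 0

/-- Extend a tuple `b : Fin N → F` to a `1`-indexed assignment `ℕ → F`
(zero outside `{1, …, N}`). -/
def extFin {F : Type*} [Zero F] {N : ℕ} (b : Fin N → F) : ℕ → F :=
  fun n => if h : 1 ≤ n ∧ n ≤ N then b ⟨n - 1, by omega⟩ else 0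

/-- The probability that the Jacobi–Trudi determinant of the partition `lam`
(with `k` parts) equals `c`, when the values of `h_1, …, h_N` are chosen
uniformly at random in `F`. -/
noncomputable def probEq (F : Type*) [Field F] [Fintype F]
    (k : ℕ) (lam : ℕ → ℕ) (N : ℕ) (c : F) : ℚ :=
  ((Finset.univ.filter fun b : Fin N → F =>
      (JTmat F k lam (extFin b)).det = c).card : ℚ) / (Fintype.card F : ℚ) ^ N

/-- `lam` records a partition with `k` (positive, weakly decreasing) parts
on the indices `0, …, k-1`. -/
def IsPartition (k : ℕ) (lam : ℕ → ℕ) : Prop :=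
  (∀ i, i + 1 < k → lam (i + 1) ≤ lam i) ∧ ∀ i, i < k → 1 ≤ lam i

section JacobiTrudi

variable {F : Type*} [Field F]

/-- A function of `x₀, …, x_{m-1}` has label `0` if it vanishes, label `1` if it is a nonzero
constant, and label `v + 2` if it is `x_v` plus a function of `x₀, …, x_{v-1}`. -/
def HasLabel {m : ℕ} (f : (Fin m → F) → F) : ℕ → Prop
  | 0 => ∀ x, f x = 0
  | 1 => ∃ c, c ≠ 0 ∧ ∀ x, f x = c
  | v + 2 => ∃ h : v < m, ∀ x y : Fin m → F, (∀ w : Fin m, w.val < v → x w = y w) →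
      f x - x ⟨v, h⟩ = f y - y ⟨v, h⟩

/-- A function labelled below `v + 2` only depends on `x₀, …, x_{v-1}`. -/
lemma HasLabel.eq_of_agree {m l v : ℕ} {f : (Fin m → F) → F} (hf : HasLabel f l) (hl : l < v + 2)
    {x y : Fin m → F} (hxy : ∀ w : Fin m, w.val < v → x w = y w) : f x = f y := by
  match l, hf with
  | 0, hf => rw [hf x, hf y]
  | 1, ⟨c, _, hf⟩ => rw [hf x, hf y]
  | u + 2, ⟨h, hf⟩ =>
    have h1 := hf x y fun w hw => hxy w (by omega)
    rw [hxy ⟨u, h⟩ (by simp; omega)] at h1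
    simpa using h1

/-- The labels strictly increase towards the top right, except that zeros may repeat. -/
def StrictNE {n : ℕ} (l : Fin n → Fin n → ℕ) : Prop :=
  ∀ i i' j j', i' ≤ i → j ≤ j' → (i' ≠ i ∨ j' ≠ j) → 0 < l i j → l i j < l i' j'

lemma StrictNE.le {n : ℕ} {l : Fin n → Fin n → ℕ} (hl : StrictNE l) {i i' j j' : Fin n}
    (hi : i' ≤ i) (hj : j ≤ j') : l i j ≤ l i' j' := by
  by_cases h : i' ≠ i ∨ j' ≠ j
  · rcases Nat.eq_zero_or_pos (l i j) with h0 | h0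
    · omega
    · exact (hl _ _ _ _ hi hj h h0).le
  · push Not at h
    rw [h.1, h.2]

lemma StrictNE.eq_zero {n : ℕ} {l : Fin n → Fin n → ℕ} (hl : StrictNE l) {i i' j j' : Fin n}
    (hi : i' ≤ i) (hj : j ≤ j') (h : i' ≠ i ∨ j' ≠ j) (h1 : l i' j' = 1) : l i j = 0 := by
  by_contra h0
  have := hl _ _ _ _ hi hj h (Nat.pos_of_ne_zero h0)
  omega

lemma StrictNE.submatrix {n : ℕ} {l : Fin (n + 1) → Fin (n + 1) → ℕ} (hl : StrictNE l)
    (r c : Fin (n + 1)) : StrictNE fun i j => l (r.succAbove i) (c.succAbove j) := by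
  intro i i' j j' hi hj h h0
  refine hl _ _ _ _ ?_ ?_ ?_ h0
  · exact (Fin.strictMono_succAbove r).monotone hi
  · exact (Fin.strictMono_succAbove c).monotone hj
  · simpa [Fin.succAbove_right_inj] using h

/-- A matrix of functions whose entries carry the labels `l`. -/
def Labeled {n m : ℕ} (M : (Fin m → F) → Matrix (Fin n) (Fin n) F) (l : Fin n → Fin n → ℕ) :
    Prop :=
  ∀ i j, HasLabel (fun x => M x i j) (l i j)

/-- Eliminating the row and the column of a nonzero entry. -/
lemma det_eq_zero_iff_of_pivot {n : ℕ} (A : Matrix (Fin (n + 1)) (Fin (n + 1)) F)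
    (r c : Fin (n + 1)) (h : A r c ≠ 0) :
    A.det = 0 ↔ (Matrix.of fun i j => A (r.succAbove i) (c.succAbove j) -
      A (r.succAbove i) c * A r (c.succAbove j) / A r c).det = 0 := by
  set B : Matrix (Fin (n + 1)) (Fin (n + 1)) F := Matrix.of fun i j =>
    if i = r then A r j else A i j - A i c / A r c * A r j with hB
  have hdet : A.det = B.det := by
    refine Matrix.det_eq_of_forall_row_eq_smul_add_const
      (fun i => if i = r then 0 else A i c / A r c) r (by simp) ?_
    intro i j
    by_cases hi : i = r <;> simp [hB, hi]
  rw [hdet, Matrix.det_succ_column B c, Finset.sum_eq_single r]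
  · have hsub : B.submatrix r.succAbove c.succAbove = Matrix.of fun i j =>
        A (r.succAbove i) (c.succAbove j) -
          A (r.succAbove i) c * A r (c.succAbove j) / A r c := by
      ext i j
      simp only [hB, Matrix.submatrix_apply, Matrix.of_apply, Fin.succAbove_ne, if_false]
      ring
    rw [hsub]
    simp [hB, h]
  · intro i _ hi
    simp [hB, hi, h]
  · simp

lemma HasLabel.cons {m v : ℕ} {f : (Fin (m + 1) → F) → F} (hf : HasLabel f (v + 3)) (a : F) :
    HasLabel (fun y : Fin m → F => f (Fin.cons a y)) (v + 2) := by
  obtain ⟨h, hf⟩ := hf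
  refine ⟨by omega, fun x y hxy => ?_⟩
  refine hf (Fin.cons a x) (Fin.cons a y) fun w => ?_
  refine Fin.cases (by simp) (fun w hw => ?_) w
  simpa using hxy w (by simpa using hw)

lemma HasLabel.exists_cons_eq_add {m : ℕ} {f : (Fin (m + 1) → F) → F} (hf : HasLabel f 2) :
    ∃ b, ∀ (a : F) (y : Fin m → F), f (Fin.cons a y) = a + b := by
  obtain ⟨_, hf⟩ := hf
  refine ⟨f 0, fun a y => ?_⟩
  have := hf (Fin.cons a y) 0 fun w hw => absurd hw (Nat.not_lt_zero _)
  simp only [Fin.zero_eta, Fin.cons_zero, Pi.zero_apply, sub_zero] at this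
  linear_combination this

/-- The labels left when the first variable is set to `a`, where the entries with label `2` are
`x₀ + b i j`. -/
noncomputable def specializeLabel {n : ℕ} (l : Fin n → Fin n → ℕ) (b : Fin n → Fin n → F) (a : F) :
    Fin n → Fin n → ℕ :=
  fun i j => if l i j = 2 ∧ a + b i j = 0 then 0 else l i j - 1

lemma StrictNE.strictNE_specializeLabel {n : ℕ} {l : Fin n → Fin n → ℕ} (hl : StrictNE l)
    (b : Fin n → Fin n → F) (a : F) : StrictNE (specializeLabel l b a) := by
  intro i i' j j' hi hj h h0
  have hle : specializeLabel l b a i j ≤ l i j - 1 := by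
    unfold specializeLabel
    split_ifs <;> omega
  have hlt := hl _ _ _ _ hi hj h (by omega)
  have heq : specializeLabel l b a i' j' = l i' j' - 1 := if_neg (by omega)
  omega

lemma Labeled.exists_specializeLabel {n m : ℕ} {M : (Fin (m + 1) → F) → Matrix (Fin n) (Fin n) F}
    {l : Fin n → Fin n → ℕ} (hM : Labeled M l) (h1 : ∀ i j, l i j ≠ 1) :
    ∃ b : Fin n → Fin n → F, ∀ a,
      Labeled (fun y : Fin m → F => M (Fin.cons a y)) (specializeLabel l b a) := by
  have hb : ∀ i j, ∃ b, l i j = 2 → ∀ (a : F) (y : Fin m → F),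
      M (Fin.cons a y) i j = a + b := by
    intro i j
    by_cases h2 : l i j = 2
    · have hij := hM i j
      rw [h2] at hij
      obtain ⟨b, hb⟩ := hij.exists_cons_eq_add
      exact ⟨b, fun _ => hb⟩
    · exact ⟨0, fun h => absurd h h2⟩
  choose b hb using hb
  refine ⟨b, fun a i j => ?_⟩
  have hij := hM i j
  unfold specializeLabel
  rcases hv : l i j with _ | _ | _ | v
  · rw [hv] at hij
    intro y
    exact hij (Fin.cons a y)
  · exact absurd hv (h1 i j)
  · by_cases h0 : a + b i j = 0
    · simp only [h0, zero_add, Nat.reduceAdd, and_self, if_true]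
      intro y
      exact (hb i j hv a y).trans h0
    · simp only [h0, and_false, if_false]
      exact ⟨a + b i j, h0, hb i j hv a⟩
  · rw [hv] at hij
    simpa using hij.cons a

lemma Labeled.le {n m : ℕ} {M : (Fin m → F) → Matrix (Fin n) (Fin n) F}
    {l : Fin n → Fin n → ℕ} (hM : Labeled M l) (i j : Fin n) : l i j ≤ m + 1 := by
  have hij := hM i j
  rcases hv : l i j with _ | _ | v
  · omega
  · omega
  · rw [hv] at hij
    obtain ⟨h, _⟩ := hij
    omega

/-- Comparing the deletion of a later index with the deletion of an earlier one. -/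
lemma Fin.succAbove_le_succAbove_of_le {n : ℕ} {c r : Fin (n + 1)} (h : c ≤ r) (i : Fin n) :
    r.succAbove i ≤ c.succAbove i := by
  simp only [Fin.le_def, Fin.succAbove, Fin.lt_def, Fin.val_castSucc] at h ⊢
  split_ifs <;> simp <;> omega

lemma Finset.sum_le_of_exceptional {ι : Type*} [Fintype ι] {S : Finset ι} {k x y : ℕ}
    (hS : S.card ≤ k) {Z : ι → ℕ}
    (hx : ∀ a ∈ S, Z a ≤ x) (hy : ∀ a ∉ S, Z a ≤ y) :
    ∑ a, Z a ≤ k * x + Fintype.card ι * y := by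
  calc ∑ a, Z a = ∑ a ∈ S, Z a + ∑ a ∈ Sᶜ, Z a := (Finset.sum_add_sum_compl S Z).symm
    _ ≤ S.card * x + Sᶜ.card * y := by
      refine add_le_add ?_ ?_
      · simpa using Finset.sum_le_card_nsmul S Z x hx
      · simpa using Finset.sum_le_card_nsmul Sᶜ Z y fun a ha => hy a (by simpa using ha)
    _ ≤ _ := by
      gcongr
      exact Finset.card_le_univ _

lemma Labeled.det_eq_prod {n m : ℕ} {M : (Fin m → F) → Matrix (Fin n) (Fin n) F}
    {l : Fin n → Fin n → ℕ} (hM : Labeled M l) (hl : StrictNE l) (h1 : ∀ i j, l i j ≠ 1)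
    (hd : ∀ i, l i i ≤ 2) (x : Fin m → F) : (M x).det = ∏ i, M x i i := by
  refine Matrix.det_of_isUpperTriangular fun i j hji => ?_
  have hji : j < i := hji
  have hij := hM i j
  have h0 : l i j = 0 := by
    by_contra h0
    have := hl i i j i le_rfl hji.le (Or.inr hji.ne') (Nat.pos_of_ne_zero h0)
    have := hd i
    have := h1 i j
    omega
  rw [h0] at hij
  exact hij x

lemma StrictNE.exists_diag_ne_one {n : ℕ} {l : Fin (n + 1) → Fin (n + 1) → ℕ} (hl : StrictNE l)
    (hd : ∃ i, l i i ≠ 1) {r c : Fin (n + 1)} (hrc : l r c = 1) :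
    ∃ i, l (r.succAbove i) (c.succAbove i) ≠ 1 := by
  rcases lt_trichotomy c r with h | rfl | h
  · have hc : c.val < n := by have := r.isLt; have := Fin.lt_def.1 h; omega
    refine ⟨⟨c, hc⟩, ?_⟩
    have e1 : r.succAbove ⟨c, hc⟩ = c := Fin.succAbove_of_castSucc_lt _ _ h
    have e2 : c < c.succAbove ⟨c, hc⟩ := by
      rw [Fin.succAbove_of_le_castSucc c ⟨c, hc⟩ le_rfl, Fin.lt_def]
      simp
    have := hl _ _ _ _ (e1.trans_le h.le) e2.le (Or.inr e2.ne') (by omega)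
    omega
  · obtain ⟨i, hi⟩ := hd
    have hic : i ≠ c := by rintro rfl; exact hi hrc
    obtain ⟨j, rfl⟩ := Fin.exists_succAbove_eq hic
    exact ⟨j, hi⟩
  · have hr : r.val < n := by have := c.isLt; have := Fin.lt_def.1 h; omega
    refine ⟨⟨r, hr⟩, ?_⟩
    have e1 : c.succAbove ⟨r, hr⟩ = r := Fin.succAbove_of_castSucc_lt _ _ h
    have e2 : r < r.succAbove ⟨r, hr⟩ := by
      rw [Fin.succAbove_of_le_castSucc r ⟨r, hr⟩ le_rfl, Fin.lt_def]
      simp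
    rw [hl.eq_zero e2.le (e1.trans_le h.le) (Or.inl e2.ne) hrc]
    exact zero_ne_one

section Count

variable [Fintype F]

/-- The number of arguments at which the matrix is singular. -/
noncomputable def zeroCount {n m : ℕ} (M : (Fin m → F) → Matrix (Fin n) (Fin n) F) : ℕ :=
  (Finset.univ.filter fun x => (M x).det = 0).card

lemma zeroCount_le {n m : ℕ} (M : (Fin m → F) → Matrix (Fin n) (Fin n) F) :
    zeroCount M ≤ Fintype.card F ^ m := by
  refine (Finset.card_filter_le _ _).trans ?_
  simp

lemma zeroCount_succ {n m : ℕ} (M : (Fin (m + 1) → F) → Matrix (Fin n) (Fin n) F) :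
    zeroCount M = ∑ a : F, zeroCount fun y : Fin m → F => M (Fin.cons a y) := by
  simp only [zeroCount, Finset.card_filter]
  rw [← Fintype.sum_prod_type' fun a (y : Fin m → F) =>
    if (M (Fin.cons a y)).det = 0 then 1 else 0]
  exact (Fintype.sum_equiv (Fin.consEquiv fun _ => F) _ _ fun _ => rfl).symm

/-- Eliminating the row and column of a constant entry keeps the remaining labels. -/
lemma Labeled.exists_pivot {n m : ℕ} {M : (Fin m → F) → Matrix (Fin (n + 1)) (Fin (n + 1)) F}
    {l : Fin (n + 1) → Fin (n + 1) → ℕ} (hM : Labeled M l) (hl : StrictNE l)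
    {r c : Fin (n + 1)} (h : l r c = 1) :
    ∃ M' : (Fin m → F) → Matrix (Fin n) (Fin n) F,
      Labeled M' (fun i j => l (r.succAbove i) (c.succAbove j)) ∧
        zeroCount M' = zeroCount M := by
  have hrc := hM r c
  rw [h] at hrc
  obtain ⟨p, hp, hrc⟩ := hrc
  replace hrc : ∀ x, M x r c = p := hrc
  refine ⟨fun x => Matrix.of fun i j => M x (r.succAbove i) (c.succAbove j) -
      M x (r.succAbove i) c * M x r (c.succAbove j) / M x r c, ?_, ?_⟩
  · intro i j
    have hij := hM (r.succAbove i) (c.succAbove j)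
    have hic := hM (r.succAbove i) c
    have hrj := hM r (c.succAbove j)
    simp only [Matrix.of_apply, hrc]
    rcases lt_or_gt_of_ne (Fin.succAbove_ne r i) with hi | hi
    · rcases lt_or_gt_of_ne (Fin.succAbove_ne c j) with hj | hj
      · rw [hl.eq_zero le_rfl hj.le (Or.inr hj.ne') h] at hrj
        have hrj' : ∀ x, M x r (c.succAbove j) = 0 := hrj
        simpa [hrj'] using hij
      · have h1 : l r c < l (r.succAbove i) c :=
          hl _ _ _ _ hi.le le_rfl (Or.inl hi.ne) (by omega)
        have h2 : l (r.succAbove i) c < l (r.succAbove i) (c.succAbove j) :=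
          hl _ _ _ _ le_rfl hj.le (Or.inr hj.ne') (by omega)
        have h3 : l r c < l r (c.succAbove j) :=
          hl _ _ _ _ le_rfl hj.le (Or.inr hj.ne') (by omega)
        have h4 : l r (c.succAbove j) < l (r.succAbove i) (c.succAbove j) :=
          hl _ _ _ _ hi.le le_rfl (Or.inl hi.ne) (by omega)
        obtain ⟨v, hv⟩ : ∃ v, l (r.succAbove i) (c.succAbove j) = v + 2 :=
          ⟨_, (Nat.sub_add_cancel (by omega)).symm⟩
        rw [hv] at h2 h4
        simp only [hv] at hij ⊢
        obtain ⟨hvm, hij⟩ := hij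
        refine ⟨hvm, fun x y hxy => ?_⟩
        have e1 := hij x y hxy
        have e2 := hic.eq_of_agree h2 hxy
        have e3 := hrj.eq_of_agree h4 hxy
        simp only at e1 e2 e3
        beta_reduce
        rw [e2, e3]
        linear_combination e1
    · rw [hl.eq_zero hi.le le_rfl (Or.inl hi.ne) h] at hic
      have hic' : ∀ x, M x (r.succAbove i) c = 0 := hic
      simpa [hic'] using hij
  · unfold zeroCount
    congr 1
    ext x
    simp only [Finset.mem_filter, Finset.mem_univ, true_and]
    exact (det_eq_zero_iff_of_pivot (M x) r c (by rw [hrc]; exact hp)).symm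

/-- If no diagonal label vanishes, then the matrix is singular with probability `O(1/q)`. -/
theorem card_mul_zeroCount_le (m : ℕ) : ∀ (n : ℕ) (M : (Fin m → F) → Matrix (Fin n) (Fin n) F)
    (l : Fin n → Fin n → ℕ), Labeled M l → StrictNE l → (∀ i, l i i ≠ 0) →
    Fintype.card F * zeroCount M ≤ n * m * Fintype.card F ^ m := by
  induction m with
  | zero =>
    intro n
    induction n with
    | zero => intro M l _ _ _; simp [zeroCount]
    | succ n ihn =>
      intro M l hM hl hd
      have h := hM.le 0 0
      have h' := hd 0
      have hrc : l 0 0 = 1 := by omega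
      obtain ⟨M', hM', hZ⟩ := hM.exists_pivot hl hrc
      rw [← hZ]
      exact (ihn M' _ hM' (hl.submatrix _ _) fun i => hd _).trans (by simp)
  | succ m ihm =>
    intro n
    induction n with
    | zero => intro M l _ _ _; simp [zeroCount]
    | succ n ihn =>
      intro M l hM hl hd
      by_cases h1 : ∃ r c, l r c = 1
      · obtain ⟨r, c, hrc⟩ := h1
        obtain ⟨M', hM', hZ⟩ := hM.exists_pivot hl hrc
        rw [← hZ]
        have hcr : c ≤ r := by
          by_contra! h
          exact hd c (hl.eq_zero h.le le_rfl (Or.inl h.ne) hrc)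
        refine (ihn M' _ hM' (hl.submatrix _ _) fun i => ?_).trans (by gcongr; omega)
        have hle := hl.le (le_refl (r.succAbove i)) (Fin.succAbove_le_succAbove_of_le hcr i)
        have := hd (r.succAbove i)
        omega
      · push Not at h1
        obtain ⟨b, hb⟩ := hM.exists_specializeLabel h1
        rw [zeroCount_succ, Finset.mul_sum]
        refine (Finset.sum_le_of_exceptional (S := Finset.univ.image fun i => -b i i) (k := n + 1)
          (x := Fintype.card F * Fintype.card F ^ m)
          (y := (n + 1) * m * Fintype.card F ^ m) ?_ ?_ ?_).trans ?_
        · simpa using Finset.card_image_le (s := Finset.univ) (f := fun i => -b i i)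
        · intro a _
          gcongr
          exact zeroCount_le _
        · intro a ha
          refine ihm _ _ _ (hb a) (hl.strictNE_specializeLabel b a) fun i => ?_
          have hab : a + b i i ≠ 0 := fun h =>
            ha (Finset.mem_image.2 ⟨i, Finset.mem_univ _, by linear_combination -h⟩)
          have := hd i
          have := h1 i i
          simp only [specializeLabel, hab, and_false, if_false]
          omega
        · exact le_of_eq (by ring)

lemma zeroCount_eq_of_forall {n m : ℕ} {M : (Fin m → F) → Matrix (Fin n) (Fin n) F}
    (h : ∀ x, (M x).det = 0) : zeroCount M = Fintype.card F ^ m := by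
  simp [zeroCount, h]

/-- If some diagonal label is not `1`, then the matrix is singular with probability at least
`1/q`. -/
theorem pow_le_card_mul_zeroCount (m : ℕ) : ∀ (n : ℕ)
    (M : (Fin m → F) → Matrix (Fin n) (Fin n) F)
    (l : Fin n → Fin n → ℕ), Labeled M l → StrictNE l → (∃ i, l i i ≠ 1) →
    Fintype.card F ^ m ≤ Fintype.card F * zeroCount M := by
  have hq : 0 < Fintype.card F := Fintype.card_pos
  induction m with
  | zero =>
    intro n
    induction n with
    | zero => rintro M l _ _ ⟨i, _⟩; exact i.elim0
    | succ n ihn =>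
      intro M l hM hl hd
      by_cases h1 : ∃ r c, l r c = 1
      · obtain ⟨r, c, hrc⟩ := h1
        obtain ⟨M', hM', hZ⟩ := hM.exists_pivot hl hrc
        rw [← hZ]
        exact ihn M' _ hM' (hl.submatrix _ _) (hl.exists_diag_ne_one hd hrc)
      · push Not at h1
        have h0 : ∀ i j, l i j = 0 := fun i j => by
          have := hM.le i j
          have := h1 i j
          omega
        rw [zeroCount_eq_of_forall fun x => ?_]
        · exact Nat.le_mul_of_pos_left _ hq
        · rw [hM.det_eq_prod hl h1 (by simp [h0])]
          have h00 := hM 0 0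
          rw [h0] at h00
          exact Finset.prod_eq_zero (Finset.mem_univ 0) (h00 x)
  | succ m ihm =>
    intro n
    induction n with
    | zero => rintro M l _ _ ⟨i, _⟩; exact i.elim0
    | succ n ihn =>
      intro M l hM hl hd
      by_cases h1 : ∃ r c, l r c = 1
      · obtain ⟨r, c, hrc⟩ := h1
        obtain ⟨M', hM', hZ⟩ := hM.exists_pivot hl hrc
        rw [← hZ]
        exact ihn M' _ hM' (hl.submatrix _ _) (hl.exists_diag_ne_one hd hrc)
      · push Not at h1
        obtain ⟨b, hb⟩ := hM.exists_specializeLabel h1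
        rw [zeroCount_succ, pow_succ']
        refine Nat.mul_le_mul_left _ ?_
        by_cases h2 : ∃ i, 3 ≤ l i i
        · obtain ⟨i, hi⟩ := h2
          refine Nat.le_of_mul_le_mul_left ?_ hq
          rw [Finset.mul_sum, ← smul_eq_mul, ← Finset.card_univ]
          refine Finset.card_nsmul_le_sum _ _ _ fun a _ => ?_
          refine ihm _ _ _ (hb a) (hl.strictNE_specializeLabel b a) ⟨i, ?_⟩
          simp only [specializeLabel]
          split_ifs <;> omega
        · push Not at h2
          refine le_trans (le_of_eq ?_)
            (Finset.single_le_sum (fun _ _ => Nat.zero_le _) (Finset.mem_univ (-b 0 0)))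
          refine (zeroCount_eq_of_forall fun x => ?_).symm
          rw [hM.det_eq_prod hl h1 fun i => Nat.lt_succ_iff.1 (h2 i)]
          have h00 := hb (-b 0 0) 0 0
          have : specializeLabel l b (-b 0 0) 0 0 = 0 := by
            have := h2 0
            simp only [specializeLabel, neg_add_cancel, and_true]
            split_ifs <;> omega
          rw [this] at h00
          exact Finset.prod_eq_zero (Finset.mem_univ 0) (h00 x)

/-- If the diagonal labels are all variables and the subdiagonal labels do not vanish, then the
matrix is singular with probability at most `1/q + O(1/q²)`. -/
theorem card_sq_mul_zeroCount_le (m : ℕ) : ∀ (n : ℕ)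
    (M : (Fin m → F) → Matrix (Fin n) (Fin n) F) (l : Fin n → Fin n → ℕ),
    0 < n → Labeled M l → StrictNE l → (∀ i, 2 ≤ l i i) →
    (∀ i j : Fin n, i.val = j.val + 1 → l i j ≠ 0) →
    Fintype.card F ^ 2 * zeroCount M ≤
      Fintype.card F ^ m * (Fintype.card F + (n * m) ^ 2) := by
  have hq : 0 < Fintype.card F := Fintype.card_pos
  induction m with
  | zero =>
    intro n M l hn hM _ hd _
    have := hM.le ⟨0, hn⟩ ⟨0, hn⟩
    have := hd ⟨0, hn⟩
    omega
  | succ m ihm =>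
    intro n
    induction n with
    | zero => intro M l hn; omega
    | succ n ihn =>
      intro M l _ hM hl hd hs
      by_cases h1 : ∃ r c, l r c = 1
      · obtain ⟨r, c, hrc⟩ := h1
        obtain ⟨M', hM', hZ⟩ := hM.exists_pivot hl hrc
        rw [← hZ]
        have hcr : c < r := by
          rcases lt_trichotomy c r with h | rfl | h
          · exact h
          · have := hd c
            omega
          · have := hd c
            rw [hl.eq_zero h.le le_rfl (Or.inl h.ne) hrc] at this
            omega
        have hd' : ∀ i, 2 ≤ l (r.succAbove i) (c.succAbove i) := fun i =>
          (hd (r.succAbove i)).trans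
            (hl.le le_rfl (Fin.succAbove_le_succAbove_of_le hcr.le i))
        refine (ihn M' _ ?_ hM' (hl.submatrix _ _) hd' fun i j hij => ?_).trans ?_
        · have := r.isLt
          have := Fin.lt_def.1 hcr
          omega
        · have hdj := hd (c.succAbove j)
          by_cases h : (r.succAbove i).val = (c.succAbove j).val + 1
          · exact hs _ _ h
          · have hle : r.succAbove i ≤ c.succAbove j := by
              simp only [Fin.le_def, Fin.succAbove, Fin.lt_def, Fin.val_castSucc] at h hcr ⊢
              split_ifs at h ⊢ <;> simp at h ⊢ <;> omega
            have := hl.le hle (le_refl (c.succAbove j))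
            omega
        · gcongr
          omega
      · push Not at h1
        by_cases h2 : ∃ i, l i i = 2
        · obtain ⟨i, hi⟩ := h2
          have hn : n = 0 := by
            by_contra hn
            obtain ⟨r, c, hrc, h⟩ : ∃ r c : Fin (n + 1), r.val = c.val + 1 ∧ (c = i ∨ r = i) := by
              by_cases h : i.val < n
              · exact ⟨⟨i + 1, by omega⟩, i, rfl, Or.inl rfl⟩
              · exact ⟨i, ⟨i - 1, by omega⟩, by simp; omega, Or.inr rfl⟩
            have hcr : c < r := by rw [Fin.lt_def]; omega
            have h0 := hs r c hrc
            have h1 := h1 r c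
            rcases h with rfl | rfl
            · have := hl r c c c hcr.le le_rfl (Or.inl hcr.ne) (by omega)
              omega
            · have := hl r r c r le_rfl hcr.le (Or.inr hcr.ne') (by omega)
              omega
          subst hn
          have hi' := hM i i
          rw [hi] at hi'
          obtain ⟨b, hb⟩ := hi'.exists_cons_eq_add
          have hle : zeroCount M ≤ Fintype.card F ^ m := by
            rw [zeroCount_succ, ← Finset.add_sum_erase _ _ (Finset.mem_univ (-b)),
              Finset.sum_eq_zero, add_zero]
            · exact zeroCount_le _
            · intro a ha
              rw [zeroCount, Finset.card_eq_zero, Finset.filter_eq_empty_iff]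
              intro y _ hdet
              rw [Matrix.det_fin_one] at hdet
              rw [show i = 0 from Fin.fin_one_eq_zero i] at hb
              exact Finset.ne_of_mem_erase ha (by linear_combination hdet - hb a y)
          calc Fintype.card F ^ 2 * zeroCount M
              ≤ Fintype.card F ^ 2 * Fintype.card F ^ m := by gcongr
            _ = Fintype.card F ^ (m + 1) * (Fintype.card F + 0) := by ring
            _ ≤ _ := by gcongr; exact Nat.zero_le _
        · push Not at h2
          obtain ⟨b, hb⟩ := hM.exists_specializeLabel h1
          have hsd : ∀ a i, 2 ≤ specializeLabel l b a i i := by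
            intro a i
            have := hd i
            have := h2 i
            simp only [specializeLabel]
            split_ifs <;> omega
          rw [zeroCount_succ, Finset.mul_sum]
          refine (Finset.sum_le_of_exceptional
            (S := Finset.univ.image fun j : Fin (n + 1) =>
              if h : j.val + 1 < n + 1 then -b ⟨j + 1, h⟩ j else 0) (k := n + 1)
            (x := Fintype.card F * ((n + 1) * m * Fintype.card F ^ m))
            (y := Fintype.card F ^ m * (Fintype.card F + ((n + 1) * m) ^ 2)) ?_ ?_ ?_).trans ?_
          · exact Finset.card_image_le.trans (by simp)
          · intro a _
            rw [pow_two, mul_assoc]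
            refine Nat.mul_le_mul_left _
              (card_mul_zeroCount_le _ _ _ _ (hb a) (hl.strictNE_specializeLabel b a) fun i => ?_)
            have := hsd a i
            omega
          · intro a ha
            refine ihm _ _ _ (Nat.succ_pos n) (hb a) (hl.strictNE_specializeLabel b a) (hsd a)
              fun i j hij => ?_
            have hab : a + b i j ≠ 0 := by
              intro h
              refine ha (Finset.mem_image.2 ⟨j, Finset.mem_univ _, ?_⟩)
              have hj : j.val + 1 < n + 1 := hij ▸ i.isLt
              have hi : (⟨j + 1, hj⟩ : Fin (n + 1)) = i := Fin.ext hij.symm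
              rw [dif_pos hj, hi]
              linear_combination -h
            have := hs i j hij
            have := h1 i j
            simp only [specializeLabel, hab, and_false, if_false]
            omega
          · have : (n + 1) * (Fintype.card F * ((n + 1) * m * Fintype.card F ^ m)) +
                Fintype.card F * (Fintype.card F ^ m * (Fintype.card F + ((n + 1) * m) ^ 2)) =
                Fintype.card F ^ (m + 1) * (Fintype.card F + (n + 1) ^ 2 * (m ^ 2 + m)) := by
              ring
            rw [this, mul_pow]
            gcongr
            nlinarith

end Count

/-- The labels of the Jacobi–Trudi matrix. -/
def jtLabel (k : ℕ) (lam : ℕ → ℕ) (i j : Fin k) : ℕ :=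
  ((lam i : ℤ) - (i : ℤ) + (j : ℤ) + 1).toNat

lemma IsPartition.le {k : ℕ} {lam : ℕ → ℕ} (h : IsPartition k lam) {i j : ℕ} (hij : i ≤ j)
    (hj : j < k) : lam j ≤ lam i := by
  induction j, hij using Nat.le_induction with
  | base => exact le_rfl
  | succ j _ ih => exact (h.1 j hj).trans (ih (by omega))

lemma IsPartition.strictNE_jtLabel {k : ℕ} {lam : ℕ → ℕ} (h : IsPartition k lam) :
    StrictNE (jtLabel k lam) := by
  intro i i' j j' hi hj hne h0
  have hlam := h.le (Fin.le_def.1 hi) i.isLt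
  have hi' := Fin.le_def.1 hi
  have hj' := Fin.le_def.1 hj
  simp only [ne_eq, Fin.ext_iff] at hne
  unfold jtLabel at h0 ⊢
  omega

lemma IsPartition.labeled_JTmat {k : ℕ} {lam : ℕ → ℕ} (h : IsPartition k lam) :
    Labeled (fun b : Fin (lam 0 + (k - 1)) → F => JTmat F k lam (extFin b))
      (jtLabel k lam) := by
  intro i j
  have hlam := h.le (Nat.zero_le i) i.isLt
  have hj := j.isLt
  simp only [JTmat, Matrix.of_apply]
  rcases hv : jtLabel k lam i j with _ | _ | v <;> unfold jtLabel at hv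
  · intro b
    beta_reduce
    rw [if_neg (by omega), if_neg (by omega)]
  · refine ⟨1, one_ne_zero, fun b => ?_⟩
    beta_reduce
    rw [if_neg (by omega), if_pos (by omega)]
  · have hd : (lam i : ℤ) - (i : ℤ) + (j : ℤ) = v + 1 := by omega
    have hN : v < lam 0 + (k - 1) := by omega
    have hext : ∀ b : Fin (lam 0 + (k - 1)) → F, extFin b (v + 1) = b ⟨v, hN⟩ := fun b =>
      dif_pos ⟨by omega, by omega⟩
    have hto : ((v : ℤ) + 1).toNat = v + 1 := by omega
    refine ⟨hN, fun x y _ => ?_⟩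
    simp only [hd]
    rw [if_pos (by omega), if_pos (by omega), hto, hext, hext, sub_self, sub_self]

end JacobiTrudi

/-- For every partition `λ` there is a constant `C > 0` (depending only on `λ`) with
`1/q ≤ P(s_λ ↦ 0) ≤ 1/q + C/q²` for every finite field `𝔽_q`; in other words
`P(s_λ ↦ 0) = 1/q + O(1/q²)`. -/
theorem prob_zero_asymptotic (k : ℕ) (hk : 0 < k) (lam : ℕ → ℕ)
    (hpart : IsPartition k lam) :
    ∃ C : ℚ, 0 < C ∧ ∀ (F : Type) [Field F] [Fintype F],
      1 / (Fintype.card F : ℚ) ≤ probEq F k lam (lam 0 + (k - 1)) 0 ∧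
      probEq F k lam (lam 0 + (k - 1)) 0 ≤
        1 / (Fintype.card F : ℚ) + C / (Fintype.card F : ℚ) ^ 2 := by
  refine ⟨((k * (lam 0 + (k - 1)) : ℕ) : ℚ) ^ 2 + 1, by positivity, fun F _ _ => ?_⟩
  have hM := hpart.labeled_JTmat (F := F)
  have hl := hpart.strictNE_jtLabel
  have hd : ∀ i, 2 ≤ jtLabel k lam i i := fun i => by
    have := hpart.2 i i.isLt
    unfold jtLabel
    omega
  have hs : ∀ i j : Fin k, i.val = j.val + 1 → jtLabel k lam i j ≠ 0 := fun i j hij => by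
    have := hpart.2 i i.isLt
    unfold jtLabel
    omega
  have hlow := pow_le_card_mul_zeroCount _ _ _ _ hM hl ⟨⟨0, hk⟩, by have := hd ⟨0, hk⟩; omega⟩
  have hupp := card_sq_mul_zeroCount_le _ _ _ _ hk hM hl hd hs
  have hq : (0 : ℚ) < Fintype.card F := by exact_mod_cast Fintype.card_pos
  generalize hN : lam 0 + (k - 1) = N at *
  have hprob : probEq F k lam N 0 =
      (zeroCount fun b : Fin N → F => JTmat F k lam (extFin b)) / (Fintype.card F : ℚ) ^ N := rfl
  rw [hprob]
  generalize (zeroCount fun b : Fin N → F => JTmat F k lam (extFin b)) = Z at *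
  have hlow' : (Fintype.card F : ℚ) ^ N ≤ Fintype.card F * Z := by exact_mod_cast hlow
  have hupp' : (Fintype.card F : ℚ) ^ 2 * Z ≤
      (Fintype.card F : ℚ) ^ N * (Fintype.card F + ((k * N : ℕ) : ℚ) ^ 2) := by
    exact_mod_cast hupp
  generalize (Fintype.card F : ℚ) = q at *
  have hqN : 0 < q ^ N := by positivity
  constructor
  · rw [div_le_div_iff₀ hq hqN]
    linarith
  · have hsum : 1 / q + (((k * N : ℕ) : ℚ) ^ 2 + 1) / q ^ 2 =
        (q + (((k * N : ℕ) : ℚ) ^ 2 + 1)) / q ^ 2 := by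
      field_simp
    rw [hsum, div_le_div_iff₀ hqN (by positivity)]
    nlinarith
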